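/- arXiv:2304.11308 — 3 statements merged into one kernel-verified Lean document; each statement's English description precedes it below -/
import Mathlib

section
/- Suppose 0 ≤ Ω < Ω* and a ≥ a* = ‖Q‖_{L²}². Then there is no minimizer for e(a): no u ∈ S_a satisfies E_a(u) = e(a). -/
open MeasureTheory Filter Topology Set Metric

noncomputable section

/-- The plane `ℝ²` with the Euclidean norm. -/
abbrev Plane : Type := EuclideanSpace ℝ (Fin 2)

def e0 : Plane := EuclideanSpace.single (0 : Fin 2) (1 : ℝ)
def e1 : Plane := EuclideanSpace.single (1 : Fin 2) (1 : ℝ)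

/-- Partial derivatives of a complex-valued function. -/
def d0 (u : Plane → ℂ) (x : Plane) : ℂ := fderiv ℝ u x e0
def d1 (u : Plane → ℂ) (x : Plane) : ℂ := fderiv ℝ u x e1

/-- `|∇u|²` for complex-valued `u`. -/
def gradSq (u : Plane → ℂ) (x : Plane) : ℝ := ‖d0 u x‖ ^ 2 + ‖d1 u x‖ ^ 2

/-- `|∇|u||²`. -/
def gradAbsSq (u : Plane → ℂ) (x : Plane) : ℝ := ‖fderiv ℝ (fun y => ‖u y‖) x‖ ^ 2

/-- Membership in `H¹(ℝ², ℂ)` (smooth-representative formulation). -/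
def InH1 (u : Plane → ℂ) : Prop :=
  Differentiable ℝ u ∧ Integrable (fun x => ‖u x‖ ^ 2) ∧ Integrable (gradSq u)

/-- Membership in the space `𝓗 = {u ∈ H¹ : ∫ V |u|² < ∞}`. -/
def InH (V : Plane → ℝ) (u : Plane → ℂ) : Prop :=
  InH1 u ∧ Integrable (fun x => V x * ‖u x‖ ^ 2)

/-- The constraint set `S_a`. -/
def Sset (V : Plane → ℝ) (a : ℝ) : Set (Plane → ℂ) :=
  {u | InH V u ∧ (∫ x : Plane, ‖u x‖ ^ 2) = a}

/-- The momentum density `x^⊥ · (iu, ∇u)`, with `x^⊥ = (-x₂, x₁)` and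
`(iu,∇u)_j = Im(ū ∂_j u)`. -/
def momentum (u : Plane → ℂ) (x : Plane) : ℝ :=
  (-(x 1)) * ((starRingEnd ℂ) (u x) * d0 u x).im + (x 0) * ((starRingEnd ℂ) (u x) * d1 u x).im

/-- The logarithmic convolution term `∫∫ ln|x-y| |u(x)|²|u(y)|²`. -/
def logConv (u : Plane → ℂ) : ℝ :=
  ∫ x : Plane, ∫ y : Plane, Real.log ‖x - y‖ * ‖u x‖ ^ 2 * ‖u y‖ ^ 2

/-- The energy functional `E_a`. -/
def Ea (V : Plane → ℝ) (Ω : ℝ) (u : Plane → ℂ) : ℝ :=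
  (∫ x : Plane, (gradSq u x + V x * ‖u x‖ ^ 2)) + (1 / 2) * logConv u
    - (1 / 2) * (∫ x : Plane, ‖u x‖ ^ 4) - Ω * (∫ x : Plane, momentum u x)

/-- `u` is a minimizer of `e(a) = inf_{S_a} E_a`. -/
def IsMinimizer (V : Plane → ℝ) (Ω a : ℝ) (u : Plane → ℂ) : Prop :=
  u ∈ Sset V a ∧ ∀ v ∈ Sset V a, Ea V Ω u ≤ Ea V Ω v

/-- `e(a) = inf_{u ∈ S_a} E_a(u)`. -/
def eInf (V : Plane → ℝ) (Ω a : ℝ) : ℝ := sInf (Ea V Ω '' Sset V a)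

/-- `f(x) → ∞` as `|x| → ∞`. -/
def TendsInfty (f : Plane → ℝ) : Prop := ∀ M : ℝ, ∃ R : ℝ, ∀ x : Plane, R ≤ ‖x‖ → M ≤ f x

/-- Hypotheses (1.10): `0 ≤ V ∈ L^∞_loc` and `liminf_{|x|→∞} V(x)/|x|² > 0`. -/
def V110 (V : Plane → ℝ) : Prop :=
  Measurable V ∧ (∀ x, 0 ≤ V x) ∧
  (∀ R : ℝ, ∃ C : ℝ, ∀ x : Plane, ‖x‖ ≤ R → V x ≤ C) ∧
  (∃ c : ℝ, 0 < c ∧ ∃ R : ℝ, ∀ x : Plane, R ≤ ‖x‖ → c * ‖x‖ ^ 2 ≤ V x)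

/-- The set of rotational velocities `W > 0` with `V(x) - (W²/4)|x|² → ∞`;
`Ω* = sup RotSet V`. -/
def RotSet (V : Plane → ℝ) : Set ℝ :=
  {W : ℝ | 0 < W ∧ TendsInfty (fun x => V x - W ^ 2 / 4 * ‖x‖ ^ 2)}

/-- `Ω < Ω*` where `Ω* = sup RotSet V` (possibly `+∞`). -/
def SubCritical (V : Plane → ℝ) (Ω : ℝ) : Prop := ∃ W ∈ RotSet V, Ω < W

def d0R (q : Plane → ℝ) (x : Plane) : ℝ := fderiv ℝ q x e0
def d1R (q : Plane → ℝ) (x : Plane) : ℝ := fderiv ℝ q x e1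

/-- `|∇q|²` for real-valued `q`. -/
def gradSqR (q : Plane → ℝ) (x : Plane) : ℝ := (d0R q x) ^ 2 + (d1R q x) ^ 2

/-- The Laplacian of a real-valued function. -/
def lapR (q : Plane → ℝ) (x : Plane) : ℝ := fderiv ℝ (d0R q) x e0 + fderiv ℝ (d1R q) x e1

/-- `Q` is the positive radially symmetric `H¹` solution of `-ΔQ + Q - Q³ = 0` on `ℝ²`. -/
def IsGroundState (Q : Plane → ℝ) : Prop :=
  ContDiff ℝ 2 Q ∧ (∀ x, 0 < Q x) ∧ (∀ x y : Plane, ‖x‖ = ‖y‖ → Q x = Q y) ∧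
  Integrable (fun x => (Q x) ^ 2) ∧ Integrable (fun x => ‖fderiv ℝ Q x‖ ^ 2) ∧
  (∀ x, - lapR Q x + Q x - (Q x) ^ 3 = 0)

/-- The Laplacian of a complex-valued function. -/
def lapC (u : Plane → ℂ) (x : Plane) : ℂ := fderiv ℝ (d0 u) x e0 + fderiv ℝ (d1 u) x e1

/-- The Euler–Lagrange equation (1.18):
`-Δu + V u + (∫ ln|x-y||u(y)|² dy) u + iΩ (x^⊥·∇u) = μ u + |u|² u`. -/
def EulerLagrange (V : Plane → ℝ) (Ω : ℝ) (u : Plane → ℂ) (μ : ℝ) : Prop :=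
  ∀ x : Plane,
    - lapC u x + (V x : ℂ) * u x
      + (((∫ y : Plane, Real.log ‖x - y‖ * ‖u y‖ ^ 2) : ℝ) : ℂ) * u x
      + Complex.I * (Ω : ℂ) * (((-(x 1) : ℝ) : ℂ) * d0 u x + ((x 0 : ℝ) : ℂ) * d1 u x)
    = (μ : ℂ) * u x + ((‖u x‖ ^ 2 : ℝ) : ℂ) * u x

/-- Condition (V): `0 ≤ V_Ω ∈ C^α_loc`, `V_Ω` vanishes only at the origin, and `V` has at
most exponential growth. Here `V_Ω(x) = V(x) - (Ω²/4)|x|²`. -/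
def CondV (V : Plane → ℝ) (Ω α : ℝ) : Prop :=
  α ∈ Ioo (0 : ℝ) 1 ∧
  (∀ x : Plane, 0 ≤ V x - Ω ^ 2 / 4 * ‖x‖ ^ 2) ∧
  (∀ x : Plane, V x - Ω ^ 2 / 4 * ‖x‖ ^ 2 = 0 ↔ x = 0) ∧
  (∀ R : ℝ, 0 < R → ∃ C : ℝ, ∀ x ∈ closedBall (0 : Plane) R, ∀ y ∈ closedBall (0 : Plane) R,
    |(V x - Ω ^ 2 / 4 * ‖x‖ ^ 2) - (V y - Ω ^ 2 / 4 * ‖y‖ ^ 2)| ≤ C * ‖x - y‖ ^ α) ∧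
  (∃ C γ : ℝ, 0 < γ ∧ ∀ x : Plane, V x ≤ C * Real.exp (γ * ‖x‖))

/-- `ε_a = (∫ |∇|u_a||²)^{-1/2}` for a family of minimizers. -/
def epsOf (u : ℝ → Plane → ℂ) (a : ℝ) : ℝ :=
  (∫ x : Plane, gradAbsSq (u a) x) ^ (-(1 : ℝ) / 2)

/-- The rescaled family
`w_a(y) = ε_a u_a(ε_a y + x_a) e^{-i((ε_a Ω/2) y·x_a^⊥ - θ)}`. -/
def wfam (Ω : ℝ) (u : ℝ → Plane → ℂ) (xa : ℝ → Plane) (a θv : ℝ) (y : Plane) : ℂ :=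
  ((epsOf u a : ℝ) : ℂ) * u a ((epsOf u a) • y + xa a) *
    Complex.exp (-Complex.I *
      ((((epsOf u a * Ω / 2) * (-(y 0) * (xa a 1) + (y 1) * (xa a 0)) - θv) : ℝ) : ℂ))

/-- The limit profile `(1/√a*) Q(x/√a*)` where `a* = ‖Q‖₂²`. -/
def Qstar (Q : Plane → ℝ) (x : Plane) : ℝ :=
  (Real.sqrt (∫ y : Plane, (Q y) ^ 2))⁻¹ * Q ((Real.sqrt (∫ y : Plane, (Q y) ^ 2))⁻¹ • x)

/-- A radial solution profile `q` of `q'' + q' / r = q - q ^ 3` with `p = q'`. -/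
structure IsProfile (q p : ℝ → ℝ) : Prop where
  hasDerivAt : ∀ r, HasDerivAt q (p r) r
  hasDerivAt_deriv : ∀ r, 0 < r → HasDerivAt p (q r - q r ^ 3 - p r / r) r
  continuous_deriv : Continuous p
  pos : ∀ r, 0 < q r
  integrableOn : IntegrableOn (fun r => r * q r ^ 2) (Ioi 0)
  integrableOn_deriv : IntegrableOn (fun r => r * p r ^ 2) (Ioi 0)

namespace IsProfile

variable {q p : ℝ → ℝ}

theorem continuous (h : IsProfile q p) : Continuous q :=
  continuous_iff_continuousAt.2 fun r => (h.hasDerivAt r).continuousAt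

theorem sq_integrableOn {f : ℝ → ℝ} (hf : Continuous f)
    (hi : IntegrableOn (fun r => r * f r ^ 2) (Ioi 0)) :
    IntegrableOn (fun r => f r ^ 2) (Ioi 1) := by
  refine Integrable.mono' (hi.mono_set (Ioi_subset_Ioi zero_le_one))
    (by fun_prop) ?_
  filter_upwards [ae_restrict_mem measurableSet_Ioi] with r hr
  have hr : 1 < r := hr
  rw [Real.norm_of_nonneg (sq_nonneg _)]
  nlinarith [sq_nonneg (f r)]

theorem tendsto_sq (h : IsProfile q p) : Tendsto (fun r => q r ^ 2) atTop (𝓝 0) := by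
  have hq := h.continuous
  have hp := h.continuous_deriv
  have iq := sq_integrableOn hq h.integrableOn
  have ip := sq_integrableOn hp h.integrableOn_deriv
  refine tendsto_zero_of_hasDerivAt_of_integrableOn_Ioi (a := 1)
    (f' := fun r => 2 * (q r * p r)) (fun r _ => ?_) ?_ iq
  · exact ((h.hasDerivAt r).pow 2).congr_deriv (by simp; ring)
  · refine Integrable.mono' (iq.add ip) (by fun_prop) (ae_of_all _ fun r => ?_)
    simp only [Pi.add_apply, Real.norm_eq_abs]
    exact abs_le.2 ⟨by nlinarith [sq_nonneg (q r + p r)], by nlinarith [sq_nonneg (q r - p r)]⟩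

theorem hasDerivAt_energy (h : IsProfile q p) {r : ℝ} (hr : 0 < r) :
    HasDerivAt (fun r => p r ^ 2 / 2 - q r ^ 2 / 2 + q r ^ 4 / 4) (-(p r ^ 2 / r)) r := by
  refine (((((h.hasDerivAt_deriv r hr).pow 2).div_const 2).sub
    (((h.hasDerivAt r).pow 2).div_const 2)).add
      (((h.hasDerivAt r).pow 4).div_const 4)).congr_deriv ?_
  simp only [Nat.cast_ofNat]
  field_simp
  ring

theorem energy_nonneg (h : IsProfile q p) {r : ℝ} (hr : 0 < r) :
    0 ≤ p r ^ 2 / 2 - q r ^ 2 / 2 + q r ^ 4 / 4 := by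
  have hanti : AntitoneOn (fun r => p r ^ 2 / 2 - q r ^ 2 / 2 + q r ^ 4 / 4) (Ici r) := by
    refine antitoneOn_of_hasDerivWithinAt_nonpos (f' := fun r => -(p r ^ 2 / r)) (convex_Ici r)
      (fun s hs => (h.hasDerivAt_energy (hr.trans_le hs)).continuousAt.continuousWithinAt)
      (fun s hs => ?_) (fun s hs => ?_)
    · rw [interior_Ici] at hs
      exact (h.hasDerivAt_energy (hr.trans hs)).hasDerivWithinAt
    · rw [interior_Ici] at hs
      have : 0 < s := hr.trans hs
      have : 0 ≤ p s ^ 2 / s := by positivity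
      linarith
  by_contra! hneg
  obtain ⟨s, hs1, hs2⟩ := ((h.tendsto_sq.eventually (gt_mem_nhds (by linarith :
    0 < -2 * (p r ^ 2 / 2 - q r ^ 2 / 2 + q r ^ 4 / 4)))).and (eventually_ge_atTop r)).exists
  have := hanti self_mem_Ici hs2 hs2
  simp only at this
  nlinarith [sq_nonneg (p s), sq_nonneg (q s ^ 2)]

theorem hasDerivAt_mul_deriv (h : IsProfile q p) {r : ℝ} (hr : 0 < r) :
    HasDerivAt (fun r => r * p r) (r * (q r - q r ^ 3)) r := by
  refine ((hasDerivAt_id r).mul (h.hasDerivAt_deriv r hr)).congr_deriv ?_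
  simp only [id]
  field_simp
  ring

theorem exists_tail (h : IsProfile q p) :
    ∃ r₀ : ℝ, 1 ≤ r₀ ∧ (∀ r, r₀ ≤ r → q r ≤ 1) ∧ (∀ r, r₀ ≤ r → p r ≤ -(q r / 2)) ∧
      MonotoneOn (fun r => r * p r) (Ici r₀) := by
  obtain ⟨r₁, hr₁⟩ := eventually_atTop.1 (h.tendsto_sq.eventually (gt_mem_nhds one_pos))
  have hq1 : ∀ r, max 1 r₁ ≤ r → q r ≤ 1 := fun r hr => by
    have := hr₁ r ((le_max_right _ _).trans hr)
    nlinarith [h.pos r]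
  have hmono : MonotoneOn (fun r => r * p r) (Ici (max 1 r₁)) := by
    have hpos : ∀ s, max 1 r₁ ≤ s → 0 < s := fun s hs =>
      one_pos.trans_le ((le_max_left _ _).trans hs)
    refine monotoneOn_of_hasDerivWithinAt_nonneg (f' := fun r => r * (q r - q r ^ 3))
      (convex_Ici _)
      (fun s hs => (h.hasDerivAt_mul_deriv (hpos s hs)).continuousAt.continuousWithinAt)
      (fun s hs => ?_) (fun s hs => ?_)
    · rw [interior_Ici] at hs
      exact (h.hasDerivAt_mul_deriv (hpos s (le_of_lt hs))).hasDerivWithinAt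
    · rw [interior_Ici] at hs
      have h1 := hq1 s (le_of_lt hs)
      have h2 := h.pos s
      have : q s ^ 3 ≤ q s := by nlinarith [mul_pos h2 h2]
      exact mul_nonneg (hpos s (le_of_lt hs)).le (by linarith)
  refine ⟨max 1 r₁, le_max_left _ _, hq1, fun r hr => ?_, hmono⟩
  have hr1 : 1 ≤ r := (le_max_left _ _).trans hr
  have hqr := h.pos r
  have hp : p r ≤ 0 := by
    by_contra! hp
    have hinc : MonotoneOn q (Ici r) := by
      refine monotoneOn_of_hasDerivWithinAt_nonneg (f' := p) (convex_Ici _)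
        h.continuous.continuousOn (fun s _ => (h.hasDerivAt s).hasDerivWithinAt)
        (fun s hs => ?_)
      rw [interior_Ici] at hs
      have hs : r < s := hs
      have h1 := hmono (mem_Ici.2 hr) (mem_Ici.2 (hr.trans hs.le)) hs.le
      simp only at h1
      by_contra! hneg
      nlinarith [mul_pos (by linarith : 0 < r) hp]
    obtain ⟨s, hs1, hs2⟩ := ((h.tendsto_sq.eventually
      (gt_mem_nhds (by positivity : 0 < q r ^ 2))).and (eventually_ge_atTop r)).exists
    have := hinc self_mem_Ici hs2 hs2
    nlinarith
  have he := h.energy_nonneg (by linarith : 0 < r)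
  have h1 := hq1 r hr
  have h2 : q r ^ 4 ≤ q r ^ 2 := by
    have : q r ^ 2 ≤ 1 := by nlinarith
    nlinarith [sq_nonneg (q r)]
  by_contra! hlt
  nlinarith

/-- Quadratic decay of a profile and its derivative. -/
theorem exists_decay (h : IsProfile q p) :
    ∃ K r₀ : ℝ, 1 ≤ r₀ ∧ ∀ r, r₀ ≤ r → q r ≤ 1 ∧ p r ≤ 0 ∧ q r ≤ K / r ^ 2 ∧ |p r| ≤ K / r ^ 2 := by
  obtain ⟨r₀, h0, hq1, hpq, hmono⟩ := h.exists_tail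
  set r₁ := max 4 r₀
  have h4 : ∀ {r}, r₁ ≤ r → 4 ≤ r := fun hr => (le_max_left _ _).trans hr
  have h5 : ∀ {r}, r₁ ≤ r → r₀ ≤ r := fun hr => (le_max_right _ _).trans hr
  have hanti : AntitoneOn (fun r => r ^ 2 * q r) (Ici r₁) := by
    have hd : ∀ s, HasDerivAt (fun r => r ^ 2 * q r) (2 * s * q s + s ^ 2 * p s) s := fun s =>
      ((hasDerivAt_pow 2 s).mul (h.hasDerivAt s)).congr_deriv (by simp)
    refine antitoneOn_of_hasDerivWithinAt_nonpos
      (f' := fun s => 2 * s * q s + s ^ 2 * p s) (convex_Ici _)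
      (fun s _ => (hd s).continuousAt.continuousWithinAt)
      (fun s _ => (hd s).hasDerivWithinAt) (fun s hs => ?_)
    rw [interior_Ici] at hs
    have h1 := h4 (le_of_lt hs)
    have h2 := hpq s (h5 (le_of_lt hs))
    have h3 := h.pos s
    have : s ^ 2 * p s ≤ s ^ 2 * (-(q s / 2)) := mul_le_mul_of_nonneg_left h2 (sq_nonneg s)
    nlinarith [mul_nonneg (mul_nonneg (by linarith : 0 ≤ s) h3.le) (by linarith : 0 ≤ s - 4)]
  set K := r₁ ^ 2 * q r₁
  have hK : 0 < K := mul_pos (pow_pos (by linarith [h4 (le_refl r₁)]) 2) (h.pos _)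
  have hqK : ∀ r, r₁ ≤ r → q r ≤ K / r ^ 2 := fun r hr => by
    have := hanti self_mem_Ici hr hr
    rw [le_div_iff₀ (pow_pos (by linarith [h4 hr]) 2)]
    simp only at this
    linarith
  refine ⟨8 * K, 2 * r₁, by linarith [h4 (le_refl r₁)], fun r hr => ?_⟩
  have h14 := h4 (le_refl r₁)
  have hr1 : r₁ ≤ r := by linarith
  have hr8 : 8 ≤ r := by linarith
  have hr2 : 0 < r ^ 2 := by positivity
  have hp : p r ≤ 0 := by linarith [hpq r (h5 hr1), h.pos r]
  refine ⟨hq1 r (h5 hr1), hp, (hqK r hr1).trans (by gcongr; linarith), ?_⟩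
  obtain ⟨s, ⟨hs1, hs2⟩, hs⟩ := exists_hasDerivAt_eq_slope q p (by linarith : r / 2 < r)
    h.continuous.continuousOn (fun s _ => h.hasDerivAt s)
  have hm := hmono (mem_Ici.2 (h5 (by linarith : r₁ ≤ s))) (mem_Ici.2 (h5 hr1)) hs2.le
  simp only at hm
  have hq2 := hqK (r / 2) (by linarith)
  have hqr := h.pos r
  rw [eq_div_iff (by linarith)] at hs
  have hs0 : 0 < s := by linarith
  have hps : p s ≤ 0 := by linarith [hpq s (h5 (by linarith)), h.pos s]
  rw [abs_of_nonpos hp, le_div_iff₀ hr2]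
  rw [le_div_iff₀ (by positivity)] at hq2
  have h7 : -(r * p r) ≤ 2 * q (r / 2) := by nlinarith
  nlinarith [mul_le_mul_of_nonneg_right h7 (sq_nonneg r)]

theorem hasDerivAt_pohozaev (h : IsProfile q p) {r : ℝ} (hr : 0 < r) :
    HasDerivAt (fun r => r * p r * q r + r ^ 2 * (p r ^ 2 / 2 - q r ^ 2 / 2 + q r ^ 4 / 4))
      (r * p r ^ 2 - r * q r ^ 4 / 2) r := by
  refine (((h.hasDerivAt_mul_deriv hr).mul (h.hasDerivAt r)).add
    ((hasDerivAt_pow 2 r).mul (h.hasDerivAt_energy hr))).congr_deriv ?_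
  simp only [Nat.cast_ofNat]
  field_simp
  ring

end IsProfile

/-- The radial integration constant `2 |B₁|` of the plane. -/
def radialConst : ℝ := 2 * (volume : Measure Plane).real (ball 0 1)

theorem radialConst_nonneg : 0 ≤ radialConst := by
  unfold radialConst; positivity

theorem integral_radial (f : ℝ → ℝ) :
    ∫ x : Plane, f ‖x‖ = radialConst * ∫ r in Ioi (0 : ℝ), r * f r := by
  rw [integral_fun_norm_addHaar volume f]
  simp [radialConst, mul_assoc]

theorem integrable_radial_iff {f : ℝ → ℝ} :
    Integrable (fun x : Plane => f ‖x‖) ↔ IntegrableOn (fun r => r * f r) (Ioi 0) := by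
  rw [integrable_fun_norm_addHaar volume]
  simp

theorem norm_e0 : ‖e0‖ = 1 := by simp [e0]

theorem norm_smul_e0_add_smul_e1 (r s : ℝ) : ‖r • e0 + s • e1‖ = √(r ^ 2 + s ^ 2) := by
  simp [EuclideanSpace.norm_eq, e0, e1]

namespace IsGroundState

variable {Q : Plane → ℝ}

theorem eq_norm (hQ : IsGroundState Q) (x : Plane) : Q x = Q (‖x‖ • e0) :=
  hQ.2.2.1 _ _ (by simp [norm_smul, norm_e0])

theorem contDiff_profile (hQ : IsGroundState Q) : ContDiff ℝ 2 fun r : ℝ => Q (r • e0) :=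
  hQ.1.comp (by fun_prop)

theorem hasDerivAt_line {f : Plane → ℝ} (hf : Differentiable ℝ f) (x v : Plane) (t : ℝ) :
    HasDerivAt (fun t : ℝ => f (x + t • v)) (fderiv ℝ f (x + t • v) v) t := by
  have h : HasDerivAt (fun t : ℝ => x + t • v) v t := by
    simpa using ((hasDerivAt_id t).smul_const v).const_add x
  exact (hf _).hasFDerivAt.comp_hasDerivAt t h

theorem hasDerivAt_ray {f : Plane → ℝ} (hf : Differentiable ℝ f) (v : Plane) (t : ℝ) :
    HasDerivAt (fun t : ℝ => f (t • v)) (fderiv ℝ f (t • v) v) t := by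
  simpa using hasDerivAt_line hf 0 v t

theorem contDiff_fderiv (hQ : IsGroundState Q) (v : Plane) :
    ContDiff ℝ 1 fun x => fderiv ℝ Q x v :=
  (hQ.1.fderiv_right (m := 1) (by norm_num)).clm_apply contDiff_const

theorem isProfile (hQ : IsGroundState Q) :
    IsProfile (fun r => Q (r • e0)) (fun r => d0R Q (r • e0)) := by
  have hdQ : Differentiable ℝ Q := hQ.1.differentiable (by norm_num)
  have hq : ∀ r : ℝ, HasDerivAt (fun r : ℝ => Q (r • e0)) (d0R Q (r • e0)) r :=
    fun r => hasDerivAt_ray hdQ e0 r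
  have hc0 : ContDiff ℝ 1 (d0R Q) := hQ.contDiff_fderiv e0
  have hc1 : ContDiff ℝ 1 (d1R Q) := hQ.contDiff_fderiv e1
  have hp : ∀ r : ℝ, HasDerivAt (fun r : ℝ => d0R Q (r • e0))
      (fderiv ℝ (d0R Q) (r • e0) e0) r :=
    fun r => hasDerivAt_ray (hc0.differentiable (by norm_num)) e0 r
  refine ⟨hq, fun r hr => ?_, hc0.continuous.comp (by fun_prop), fun r => hQ.2.1 _, ?_, ?_⟩
  · have hsqrt : ∀ s : ℝ, HasDerivAt (fun s => √(r ^ 2 + s ^ 2)) (s / √(r ^ 2 + s ^ 2)) s := by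
      intro s
      have h := (((hasDerivAt_pow 2 s).const_add (r ^ 2)).sqrt (by positivity))
      refine h.congr_deriv ?_
      simp only [Nat.cast_ofNat, Nat.add_one_sub_one, pow_one]
      field_simp
    have h1 : ∀ s : ℝ, d1R Q (r • e0 + s • e1)
        = d0R Q (√(r ^ 2 + s ^ 2) • e0) * (s / √(r ^ 2 + s ^ 2)) := by
      intro s
      have ha := hasDerivAt_line hdQ (r • e0) e1 s
      have hb : HasDerivAt (fun s : ℝ => Q (r • e0 + s • e1))
          (d0R Q (√(r ^ 2 + s ^ 2) • e0) * (s / √(r ^ 2 + s ^ 2))) s := by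
        have := (hq (√(r ^ 2 + s ^ 2))).comp s (hsqrt s)
        refine this.congr_of_eventuallyEq (.of_forall fun t => ?_)
        simp only [Function.comp_apply]
        rw [hQ.eq_norm, norm_smul_e0_add_smul_e1]
      exact ha.unique hb
    have h2 : fderiv ℝ (d1R Q) (r • e0) e1 = d0R Q (r • e0) / r := by
      have ha := hasDerivAt_line (hc1.differentiable (by norm_num)) (r • e0) e1 0
      have hs0 : √(r ^ 2 + 0 ^ 2) = r := by simp [Real.sqrt_sq hr.le]
      have hb := ((hp (√(r ^ 2 + 0 ^ 2))).comp 0 (hsqrt 0)).mul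
        ((hasDerivAt_id (0 : ℝ)).div (hsqrt 0) (by rw [hs0]; exact hr.ne'))
      have hb' := hb.congr_of_eventuallyEq
        (f₁ := fun s : ℝ => d1R Q (r • e0 + s • e1)) (.of_forall fun s => h1 s)
      have := ha.unique hb'
      simp only [zero_smul, add_zero] at this
      rw [this]
      simp only [Function.comp_apply, hs0, id]
      field_simp
      simp [mul_comm]
    have h3 := hQ.2.2.2.2.2 (r • e0)
    refine (hp r).congr_deriv ?_
    rw [lapR, h2] at h3
    linarith
  · refine integrable_radial_iff.1 (hQ.2.2.2.1.congr (ae_of_all _ fun x => ?_))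
    simp only
    rw [hQ.eq_norm]
  · refine integrable_radial_iff.1 ?_
    refine hQ.2.2.2.2.1.mono' ?_ ?_
    · exact (Continuous.aestronglyMeasurable (by
        have := hc0.continuous
        fun_prop))
    · have hne : ∀ᵐ x : Plane, x ≠ 0 := by simp [ae_iff]
      filter_upwards [hne] with x hx
      have hx' : 0 < ‖x‖ := norm_pos_iff.2 hx
      have ha := hasDerivAt_ray hdQ (‖x‖⁻¹ • x) ‖x‖
      have hb := (hq ‖x‖).congr_of_eventuallyEq
        (f₁ := fun t : ℝ => Q (t • ‖x‖⁻¹ • x)) (by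
          filter_upwards [lt_mem_nhds hx'] with t ht
          apply hQ.2.2.1
          simp [norm_smul, norm_e0, hx'.ne'])
      have h := ha.unique hb
      rw [smul_inv_smul₀ hx'.ne'] at h
      rw [← h, Real.norm_of_nonneg (sq_nonneg _)]
      have hle := (fderiv ℝ Q x).le_opNorm (‖x‖⁻¹ • x)
      rw [norm_smul, norm_inv, norm_norm, inv_mul_cancel₀ hx'.ne', mul_one] at hle
      rw [← sq_abs, ← Real.norm_eq_abs]
      gcongr

end IsGroundState

theorem locallyIntegrable_log_norm : LocallyIntegrable fun x : Plane => Real.log ‖x‖ := by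
  refine (locallyIntegrable_iff).2 fun K hK => ?_
  obtain ⟨ρ, hρ⟩ := hK.isBounded.subset_closedBall 0
  refine IntegrableOn.mono_set ?_ hρ
  rw [← integrable_indicator_iff measurableSet_closedBall]
  have heq : (closedBall (0 : Plane) ρ).indicator (fun x => Real.log ‖x‖)
      = fun x => (Iic ρ).indicator Real.log ‖x‖ := by
    ext x
    simp [indicator]
  rw [heq, integrable_radial_iff]
  have heq' : (fun r => r * (Iic ρ).indicator Real.log r)
      = (Iic ρ).indicator fun r => r * Real.log r := by
    ext r
    simp [indicator]
  rw [heq', IntegrableOn, integrable_indicator_iff measurableSet_Iic, IntegrableOn,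
    Measure.restrict_restrict measurableSet_Iic]
  exact (Real.continuous_mul_log.integrableOn_Icc (a := 0) (b := ρ)).mono_set
    fun r hr => ⟨(mem_Ioi.1 hr.2).le, hr.1⟩

theorem logConv_le {u : Plane → ℂ} (hu : Continuous u) (hs : HasCompactSupport u) {R : ℝ}
    (hR : 0 < R) :
    logConv u ≤ 2 * (∫ x, ‖u x‖ ^ 2) * (R * ∫ x, ‖x‖ * ‖u x‖ ^ 2)
      - Real.log R * (∫ x, ‖u x‖ ^ 2) ^ 2 := by
  set ρ : Plane → ℝ := fun x => ‖u x‖ ^ 2 with hρ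
  have hρc : Continuous ρ := by fun_prop
  have hρs : HasCompactSupport ρ := hs.comp_left (g := fun z : ℂ => ‖z‖ ^ 2) (by simp)
  have hint : ∀ x, Integrable fun y => Real.log ‖x - y‖ * ρ y := fun x => by
    have := hρs.convolutionExists_left (ContinuousLinearMap.mul ℝ ℝ) hρc
      locallyIntegrable_log_norm x
    simpa [ConvolutionExistsAt, mul_comm] using this
  set h : Plane → ℝ := fun x => ∫ y, Real.log ‖x - y‖ * ρ y with hh
  have hhc : Continuous h := by
    have := hρs.continuous_convolution_left (ContinuousLinearMap.mul ℝ ℝ) hρc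
      locallyIntegrable_log_norm
    refine this.congr fun x => ?_
    simp [convolution_def, hh, mul_comm]
  have iρ : Integrable ρ := hρc.integrable_of_hasCompactSupport hρs
  have iρ1 : Integrable fun x => ‖x‖ * ρ x :=
    (continuous_norm.mul hρc).integrable_of_hasCompactSupport hρs.mul_left
  set m := ∫ x, ρ x with hm
  set M := ∫ x, ‖x‖ * ρ x with hM
  have hle : ∀ x, h x ≤ R * ‖x‖ * m + R * M - Real.log R * m := fun x => by
    have i1 : Integrable fun y => (R * ‖x‖ - Real.log R) * ρ y + R * (‖y‖ * ρ y) :=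
      (iρ.const_mul _).add (iρ1.const_mul _)
    have hval : ∫ y, ((R * ‖x‖ - Real.log R) * ρ y + R * (‖y‖ * ρ y))
        = R * ‖x‖ * m + R * M - Real.log R * m := by
      rw [integral_add (iρ.const_mul _) (iρ1.const_mul _), integral_const_mul,
        integral_const_mul]
      ring
    rw [← hval]
    refine integral_mono_ae (hint x) i1 ?_
    have hne : ∀ᵐ y : Plane, y ≠ x := by simp [ae_iff]
    filter_upwards [hne] with y hy
    have hpos : 0 < ‖x - y‖ := norm_pos_iff.2 (sub_ne_zero.2 hy.symm)
    have h1 : Real.log R + Real.log ‖x - y‖ ≤ R * ‖x‖ + R * ‖y‖ := by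
      rw [← Real.log_mul hR.ne' hpos.ne']
      have := Real.log_le_sub_one_of_pos (mul_pos hR hpos)
      nlinarith [norm_sub_le x y]
    have h2 : 0 ≤ ρ y := sq_nonneg _
    nlinarith
  have hconv : logConv u = ∫ x, ρ x * h x := by
    refine integral_congr_ae (ae_of_all _ fun x => ?_)
    simp only [hh]
    rw [← integral_const_mul]
    exact integral_congr_ae (ae_of_all _ fun y => by simp only [hρ]; ring)
  have i2 : Integrable fun x => (R * m) * (‖x‖ * ρ x) + (R * M - Real.log R * m) * ρ x :=
    (iρ1.const_mul _).add (iρ.const_mul _)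
  calc logConv u = ∫ x, ρ x * h x := hconv
    _ ≤ ∫ x, ((R * m) * (‖x‖ * ρ x) + (R * M - Real.log R * m) * ρ x) := by
      refine integral_mono
        ((hρc.mul hhc).integrable_of_hasCompactSupport hρs.mul_right) i2 fun x => ?_
      have h2 : 0 ≤ ρ x := sq_nonneg _
      have := mul_le_mul_of_nonneg_left (hle x) h2
      simp only
      linarith
    _ = 2 * m * (R * M) - Real.log R * m ^ 2 := by
      rw [integral_add (iρ1.const_mul _) (iρ.const_mul _), integral_const_mul,
        integral_const_mul]
      ring

section RealValued

variable {W : Plane → ℝ}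

theorem fderiv_ofReal (hW : Differentiable ℝ W) (x v : Plane) :
    fderiv ℝ (fun x => (W x : ℂ)) x v = (fderiv ℝ W x v : ℂ) := by
  have h := Complex.ofRealCLM.hasFDerivAt.comp x (hW x).hasFDerivAt
  have h' : HasFDerivAt (fun x => (W x : ℂ)) (Complex.ofRealCLM.comp (fderiv ℝ W x)) x := h
  rw [h'.fderiv]
  simp

theorem momentum_ofReal (hW : Differentiable ℝ W) (x : Plane) :
    momentum (fun x => (W x : ℂ)) x = 0 := by
  simp [momentum, d0, d1, fderiv_ofReal hW]

theorem gradSq_ofReal_radial (hW : Differentiable ℝ W) {k : ℝ → ℝ} (hk : ∀ x, W x = k ‖x‖)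
    {x : Plane} (hx : x ≠ 0) {k' : ℝ} (hk' : HasDerivAt k k' ‖x‖) :
    gradSq (fun x => (W x : ℂ)) x = k' ^ 2 := by
  have hpos : 0 < ‖x‖ := norm_pos_iff.2 hx
  have h1 := ((hasStrictFDerivAt_norm_sq x).hasFDerivAt).sqrt (by positivity)
  have hfun : (fun y : Plane => √(‖y‖ ^ 2)) = fun y => ‖y‖ := by
    ext y; exact Real.sqrt_sq (norm_nonneg y)
  rw [hfun, Real.sqrt_sq hpos.le] at h1
  have h2 := hk'.comp_hasFDerivAt x h1
  have hWk : W = k ∘ fun y => ‖y‖ := funext hk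
  rw [← hWk] at h2
  have hn : ‖x‖ ^ 2 = x 0 ^ 2 + x 1 ^ 2 := by
    simp [EuclideanSpace.norm_sq_eq]
  have hv0 : fderiv ℝ W x e0 = k' * (x 0 / ‖x‖) := by
    rw [h2.fderiv]
    simp [e0, EuclideanSpace.inner_single_right]
    field_simp
    exact Or.inl trivial
  have hv1 : fderiv ℝ W x e1 = k' * (x 1 / ‖x‖) := by
    rw [h2.fderiv]
    simp [e1, EuclideanSpace.inner_single_right]
    field_simp
    exact Or.inl trivial
  simp only [gradSq, d0, d1, fderiv_ofReal hW, Complex.norm_real, Real.norm_eq_abs, sq_abs,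
    hv0, hv1]
  field_simp
  rw [hn]

end RealValued

/-- A smooth cutoff equal to `1` on `[-1, 1]` and to `0` outside `[-√2, √2]`. -/
def cutoff (r : ℝ) : ℝ := Real.smoothTransition (2 - r ^ 2)

theorem contDiff_cutoff : ContDiff ℝ 1 cutoff :=
  (Real.smoothTransition.contDiff (n := 1)).comp (by fun_prop)

theorem cutoff_nonneg (r : ℝ) : 0 ≤ cutoff r := Real.smoothTransition.nonneg _

theorem cutoff_le_one (r : ℝ) : cutoff r ≤ 1 := Real.smoothTransition.le_one _

theorem cutoff_eq_one {r : ℝ} (hr : |r| ≤ 1) : cutoff r = 1 :=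
  Real.smoothTransition.one_of_one_le (by linarith [(sq_le_one_iff_abs_le_one r).2 hr])

theorem cutoff_eq_zero {r : ℝ} (hr : 2 ≤ r ^ 2) : cutoff r = 0 :=
  Real.smoothTransition.zero_of_nonpos (by linarith)

theorem hasDerivAt_cutoff (r : ℝ) : HasDerivAt cutoff (deriv cutoff r) r :=
  ((contDiff_cutoff.differentiable (by norm_num)) r).hasDerivAt

theorem deriv_cutoff_eq_zero_of_lt_one {r : ℝ} (h0 : |r| < 1) :
    deriv cutoff r = 0 := by
  have : cutoff =ᶠ[𝓝 r] fun _ => 1 := by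
    filter_upwards [(continuous_abs.tendsto r).eventually (gt_mem_nhds h0)] with s hs
    exact cutoff_eq_one hs.le
  rw [this.deriv_eq, deriv_const]

theorem deriv_cutoff_eq_zero_of_two_lt {r : ℝ} (h : 2 < r) : deriv cutoff r = 0 := by
  have : cutoff =ᶠ[𝓝 r] fun _ => 0 := by
    filter_upwards [lt_mem_nhds h] with s hs
    exact cutoff_eq_zero (by nlinarith)
  rw [this.deriv_eq, deriv_const]

theorem exists_bound_deriv_cutoff : ∃ M, ∀ r, |deriv cutoff r| ≤ M := by
  have hs : HasCompactSupport cutoff :=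
    HasCompactSupport.of_support_subset_isCompact (isCompact_Icc (a := -2) (b := 2)) fun r hr => by
      by_contra hout
      refine hr (cutoff_eq_zero ?_)
      by_contra! h
      exact hout ⟨by nlinarith, by nlinarith⟩
  exact hs.deriv.exists_bound_of_continuous (contDiff_cutoff.continuous_deriv le_rfl)

/-- The derivative of `r ↦ R * q (R * r) * cutoff r` when `p = q'`. -/
def truncDeriv (q p : ℝ → ℝ) (R r : ℝ) : ℝ :=
  R * (R * p (R * r) * cutoff r + q (R * r) * deriv cutoff r)

namespace IsProfile

variable {q p : ℝ → ℝ}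

theorem hasDerivAt_trunc (h : IsProfile q p) (R r : ℝ) :
    HasDerivAt (fun r => R * q (R * r) * cutoff r) (truncDeriv q p R r) r := by
  have h1 : HasDerivAt (fun r => q (R * r)) (p (R * r) * R) r := by
    have := (h.hasDerivAt (R * r)).comp r ((hasDerivAt_id r).const_mul R)
    simpa [Function.comp_def] using this
  refine ((h1.const_mul R).mul (hasDerivAt_cutoff r)).congr_deriv ?_
  rw [truncDeriv]
  ring

theorem continuous_truncDeriv (h : IsProfile q p) (R : ℝ) : Continuous (truncDeriv q p R) := by
  have h1 := h.continuous
  have h2 := h.continuous_deriv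
  have h3 := contDiff_cutoff.continuous
  have h4 := contDiff_cutoff.continuous_deriv le_rfl
  unfold truncDeriv
  fun_prop

theorem integral_core_le (h : IsProfile q p) {K R : ℝ} (hR : 1 ≤ R) (hq : q R ≤ 1) (hp : p R ≤ 0)
    (hpK : |p R| ≤ K / R ^ 2) :
    ∫ r in (0 : ℝ)..1, R ^ 4 * (r * p (R * r) ^ 2 - r * q (R * r) ^ 4 / 2) ≤ K ^ 2 / 2 := by
  have h1 := h.continuous
  have h2 := h.continuous_deriv
  have hR0 : 0 < R := by linarith
  set F : ℝ → ℝ := fun r =>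
    r * p r * q r + r ^ 2 * (p r ^ 2 / 2 - q r ^ 2 / 2 + q r ^ 4 / 4)
  have hFc : Continuous F := by fun_prop
  have hint : ∫ r in (0 : ℝ)..1, R ^ 4 * (r * p (R * r) ^ 2 - r * q (R * r) ^ 4 / 2)
      = R ^ 2 * F (R * 1) - R ^ 2 * F (R * 0) := by
    refine intervalIntegral.integral_eq_sub_of_hasDerivAt_of_le (f := fun r => R ^ 2 * F (R * r))
      zero_le_one (by fun_prop) (fun r hr => ?_) (Continuous.intervalIntegrable (by fun_prop) _ _)
    have := ((h.hasDerivAt_pohozaev (mul_pos hR0 hr.1)).comp r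
      ((hasDerivAt_id r).const_mul R)).const_mul (R ^ 2)
    refine this.congr_deriv ?_
    ring
  rw [hint]
  have hF0 : F (R * 0) = 0 := by simp [F]
  rw [hF0, mul_one, mul_zero, sub_zero]
  have hqR := h.pos R
  have hK : (R ^ 2 * p R) ^ 2 ≤ K ^ 2 := by
    rw [le_div_iff₀ (by positivity)] at hpK
    rw [← sq_abs, abs_mul, abs_of_nonneg (sq_nonneg R)]
    have := mul_nonneg (abs_nonneg (p R)) (sq_nonneg R)
    nlinarith
  have hle : F R ≤ R ^ 2 * (p R ^ 2 / 2) := by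
    have hpq : R * p R * q R ≤ 0 := by
      have := mul_nonneg (mul_nonneg hR0.le (neg_nonneg.2 hp)) hqR.le
      nlinarith
    have hq4 : q R ^ 4 ≤ q R ^ 2 := by
      have : q R ^ 2 ≤ 1 := by nlinarith
      nlinarith [sq_nonneg (q R)]
    have : p R ^ 2 / 2 - q R ^ 2 / 2 + q R ^ 4 / 4 ≤ p R ^ 2 / 2 := by
      nlinarith [sq_nonneg (q R)]
    have := mul_le_mul_of_nonneg_left this (sq_nonneg R)
    simp only [F]
    linarith
  have := mul_le_mul_of_nonneg_left hle (sq_nonneg R)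
  nlinarith

theorem trunc_tail_le (h : IsProfile q p) {K M R r : ℝ} (hM : |deriv cutoff r| ≤ M) (hR : 1 ≤ R)
    (hr1 : 1 ≤ r) (hr2 : r ≤ 2) (hqK : q (R * r) ≤ K / (R * r) ^ 2)
    (hpK : |p (R * r)| ≤ K / (R * r) ^ 2) :
    r * truncDeriv q p R r ^ 2 ≤ 2 * (K * (1 + M)) ^ 2 := by
  have hR0 : 0 < R := by linarith
  have hK : 0 ≤ K := by
    by_contra! hneg
    have := (abs_nonneg _).trans hpK
    have h' : K / (R * r) ^ 2 < 0 := div_neg_of_neg_of_pos hneg (by positivity)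
    linarith
  have hKle : K / (R * r) ^ 2 ≤ K / R ^ 2 := by
    gcongr
    nlinarith
  have hbound : |truncDeriv q p R r| ≤ K * (1 + M) := by
    have hM0 : 0 ≤ M := (abs_nonneg _).trans hM
    calc |truncDeriv q p R r|
        ≤ R * (R * |p (R * r)| * cutoff r + q (R * r) * |deriv cutoff r|) := by
          rw [truncDeriv, abs_mul, abs_of_pos hR0]
          gcongr
          refine (abs_add_le _ _).trans (le_of_eq ?_)
          rw [abs_mul, abs_mul, abs_mul, abs_of_pos hR0, abs_of_nonneg (cutoff_nonneg r),
            abs_of_pos (h.pos _)]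
      _ ≤ R * (R * (K / R ^ 2) * 1 + K / R ^ 2 * M) := by
          have hc := cutoff_le_one r
          have hc0 := cutoff_nonneg r
          have h1 := hpK.trans hKle
          have h2 := hqK.trans hKle
          gcongr
      _ = K * (1 + M / R) := by field_simp
      _ ≤ K * (1 + M) := by
          gcongr
          exact div_le_self hM0 hR
  have := sq_le_sq' (by linarith [(abs_le.1 hbound).1]) (abs_le.1 hbound).2
  nlinarith [sq_nonneg (truncDeriv q p R r)]

/-- The truncated rescaled profile has bounded energy, uniformly in the scale. -/
theorem exists_trunc_energy_le (h : IsProfile q p) :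
    ∃ C r₀ : ℝ, 1 ≤ r₀ ∧ ∀ R, r₀ ≤ R →
      ∫ r in Ioi (0 : ℝ), r * (truncDeriv q p R r ^ 2 - (R * q (R * r) * cutoff r) ^ 4 / 2) ≤ C := by
  obtain ⟨K, r₀, h0, hdec⟩ := h.exists_decay
  obtain ⟨M, hM⟩ := exists_bound_deriv_cutoff
  refine ⟨K ^ 2 / 2 + 2 * (K * (1 + M)) ^ 2, r₀, h0, fun R hR => ?_⟩
  have hR1 : 1 ≤ R := h0.trans hR
  have c1 := h.continuous
  have c2 := h.continuous_deriv
  have c3 := h.continuous_truncDeriv R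
  have c4 := contDiff_cutoff.continuous
  set f : ℝ → ℝ := fun r => r * (truncDeriv q p R r ^ 2 - (R * q (R * r) * cutoff r) ^ 4 / 2)
  have hf : Continuous f := by fun_prop
  have hzero : ∀ r ∈ Ioi (0 : ℝ) \ Ioc 0 2, f r = 0 := fun r hr => by
    have h2 : 2 < r := by
      by_contra! hle
      exact hr.2 ⟨hr.1, hle⟩
    simp [f, truncDeriv, cutoff_eq_zero (by nlinarith : 2 ≤ r ^ 2),
      deriv_cutoff_eq_zero_of_two_lt h2]
  rw [setIntegral_eq_of_subset_of_forall_sdiff_eq_zero measurableSet_Ioi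
    (fun r hr => hr.1) hzero, ← intervalIntegral.integral_of_le zero_le_two,
    ← intervalIntegral.integral_add_adjacent_intervals (hf.intervalIntegrable 0 1)
      (hf.intervalIntegrable 1 2)]
  refine add_le_add ?_ ?_
  · refine le_trans (le_of_eq ?_) (h.integral_core_le hR1 (hdec R hR).1 (hdec R hR).2.1
      (hdec R hR).2.2.2)
    rw [intervalIntegral.integral_of_le zero_le_one, intervalIntegral.integral_of_le zero_le_one,
      integral_Ioc_eq_integral_Ioo, integral_Ioc_eq_integral_Ioo]
    refine setIntegral_congr_fun measurableSet_Ioo fun r hr => ?_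
    have hr' : |r| < 1 := by rw [abs_of_pos hr.1]; exact hr.2
    simp only [f, truncDeriv, cutoff_eq_one hr'.le, deriv_cutoff_eq_zero_of_lt_one hr']
    ring
  · have := intervalIntegral.integral_mono_on (μ := volume) (one_le_two (α := ℝ))
      (hf.intervalIntegrable 1 2)
      (intervalIntegrable_const (c := 2 * (K * (1 + M)) ^ 2)) fun r hr => ?_
    · simpa [show (2 : ℝ) - 1 = 1 by norm_num] using this
    · have hRr : r₀ ≤ R * r := by nlinarith [hr.1]
      have h1 := h.trunc_tail_le (hM r) hR1 hr.1 hr.2 (hdec _ hRr).2.2.1 (hdec _ hRr).2.2.2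
      have h2 : 0 ≤ r * (R * q (R * r) * cutoff r) ^ 4 :=
        mul_nonneg (by linarith [hr.1]) (by positivity)
      simp only [f]
      linarith

theorem integrableOn_sq_mul_sq (h : IsProfile q p) :
    IntegrableOn (fun r => r * (r * q r ^ 2)) (Ioi 0) := by
  obtain ⟨K, r₀, h0, hdec⟩ := h.exists_decay
  have c1 := h.continuous
  have hc : Continuous fun r => r * (r * q r ^ 2) := by fun_prop
  have hpos : (0 : ℝ) < r₀ := by linarith
  rw [← Ioc_union_Ioi_eq_Ioi hpos.le]
  refine IntegrableOn.union ((hc.integrableOn_Icc).mono_set Ioc_subset_Icc_self) ?_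
  have hi := (integrableOn_Ioi_rpow_of_lt (by norm_num : (-2 : ℝ) < -1) hpos).const_mul (K ^ 2)
  refine hi.mono' hc.aestronglyMeasurable ?_
  filter_upwards [ae_restrict_mem measurableSet_Ioi] with r hr
  have hr : r₀ < r := hr
  have hr0 : 0 < r := hpos.trans hr
  have hK := (hdec r hr.le).2.2.1
  have hq := h.pos r
  rw [Real.norm_of_nonneg (by positivity), Real.rpow_neg hr0.le, Real.rpow_two]
  have : q r ^ 2 ≤ (K / r ^ 2) ^ 2 := by gcongr
  calc r * (r * q r ^ 2) ≤ r * (r * (K / r ^ 2) ^ 2) := by gcongr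
    _ = K ^ 2 * (r ^ 2)⁻¹ := by field_simp

end IsProfile

theorem integral_scale {R : ℝ} (hR : 0 < R) (f : Plane → ℝ) :
    ∫ x, R ^ 2 * f (R • x) = ∫ x, f x := by
  rw [integral_const_mul, Measure.integral_comp_smul]
  simp only [finrank_euclideanSpace, Fintype.card_fin, smul_eq_mul]
  rw [abs_of_pos (by positivity), ← mul_assoc, mul_inv_cancel₀ (by positivity), one_mul]

/-- The truncated rescaled function `R Q(R x)`. -/
def trunc (Q : Plane → ℝ) (R : ℝ) (x : Plane) : ℝ := R * Q (R • x) * cutoff ‖x‖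

theorem trunc_eq_zero (Q : Plane → ℝ) (R : ℝ) {x : Plane} (hx : 2 ≤ ‖x‖) : trunc Q R x = 0 := by
  rw [trunc, cutoff_eq_zero (by nlinarith), mul_zero]

theorem hasCompactSupport_trunc (Q : Plane → ℝ) (R : ℝ) : HasCompactSupport (trunc Q R) :=
  HasCompactSupport.of_support_subset_isCompact (isCompact_closedBall 0 2) fun x hx => by
    by_contra hout
    refine hx (trunc_eq_zero Q R ?_)
    simp only [mem_closedBall, dist_zero_right, not_le] at hout
    exact hout.le

theorem differentiable_trunc {Q : Plane → ℝ} (hQ : Differentiable ℝ Q) (R : ℝ) :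
    Differentiable ℝ (trunc Q R) := by
  have hc : Differentiable ℝ fun x : Plane => cutoff ‖x‖ := by
    have h : Differentiable ℝ fun x : Plane => Real.smoothTransition (2 - ‖x‖ ^ 2) :=
      ((Real.smoothTransition.contDiff (n := 1)).differentiable (by norm_num)).comp
        ((differentiable_const _).sub (differentiable_id.norm_sq ℝ))
    exact h
  exact ((hQ.comp (differentiable_id.const_smul R)).const_mul R).mul hc

namespace IsGroundState

variable {Q : Plane → ℝ}

theorem differentiable (hQ : IsGroundState Q) : Differentiable ℝ Q :=
  hQ.1.differentiable (by norm_num)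

theorem integrable_norm_mul_sq (hQ : IsGroundState Q) :
    Integrable fun x => ‖x‖ * Q x ^ 2 := by
  refine (integrable_radial_iff.2 hQ.isProfile.integrableOn_sq_mul_sq).congr
    (ae_of_all _ fun x => ?_)
  simp only
  rw [← hQ.eq_norm]

theorem continuous_trunc (hQ : IsGroundState Q) (R : ℝ) : Continuous (trunc Q R) :=
  (differentiable_trunc hQ.differentiable R).continuous

theorem trunc_sq_le (R : ℝ) (x : Plane) : trunc Q R x ^ 2 ≤ R ^ 2 * Q (R • x) ^ 2 := by
  have h1 := cutoff_nonneg ‖x‖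
  have h2 := cutoff_le_one ‖x‖
  have h3 : cutoff ‖x‖ ^ 2 ≤ 1 := by nlinarith
  have := mul_le_mul_of_nonneg_left h3 (sq_nonneg (R * Q (R • x)))
  rw [trunc, mul_pow]
  linarith

theorem integral_trunc_sq_le (hQ : IsGroundState Q) {R : ℝ} (hR : 0 < R) :
    ∫ x, trunc Q R x ^ 2 ≤ ∫ x, Q x ^ 2 := by
  rw [← integral_scale hR fun x => Q x ^ 2]
  refine integral_mono_of_nonneg (ae_of_all _ fun x => sq_nonneg _) ?_
    (ae_of_all _ fun x => trunc_sq_le R x)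
  exact ((integrable_comp_smul_iff volume _ hR.ne').2 hQ.2.2.2.1).const_mul _

theorem integral_norm_mul_trunc_sq_le (hQ : IsGroundState Q) {R : ℝ} (hR : 0 < R) :
    R * ∫ x, ‖x‖ * trunc Q R x ^ 2 ≤ ∫ x, ‖x‖ * Q x ^ 2 := by
  rw [← integral_scale hR fun x => ‖x‖ * Q x ^ 2, ← integral_const_mul]
  refine integral_mono_of_nonneg (ae_of_all _ fun x => by positivity) ?_
    (ae_of_all _ fun x => ?_)
  · exact ((integrable_comp_smul_iff volume _ hR.ne').2 hQ.integrable_norm_mul_sq).const_mul _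
  · have h := mul_le_mul_of_nonneg_left (trunc_sq_le (Q := Q) R x)
      (by positivity : 0 ≤ R * ‖x‖)
    simp only [norm_smul, Real.norm_of_nonneg hR.le]
    linarith

theorem exists_pos_le_integral_trunc_sq (hQ : IsGroundState Q) :
    ∃ n : ℝ, 0 < n ∧ ∀ R, 1 ≤ R → n ≤ ∫ x, trunc Q R x ^ 2 := by
  refine ⟨∫ x, trunc Q 1 x ^ 2 * cutoff (2 * ‖x‖), ?_, fun R hR => ?_⟩
  · refine Continuous.integral_pos_of_hasCompactSupport_nonneg_nonzero (x := 0) ?_ ?_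
      (fun x => mul_nonneg (sq_nonneg _) (cutoff_nonneg _)) ?_
    · have h1 := hQ.continuous_trunc 1
      have h2 := contDiff_cutoff.continuous
      fun_prop
    · exact HasCompactSupport.mul_right
        ((hasCompactSupport_trunc Q 1).comp_left (g := fun t : ℝ => t ^ 2) (by simp))
    · have := hQ.2.1 0
      simp [trunc, cutoff_eq_one, this.ne']
  · have hR0 : 0 < R := by linarith
    rw [← integral_scale hR0]
    refine integral_mono_of_nonneg (ae_of_all _ fun x =>
      mul_nonneg (sq_nonneg _) (mul_nonneg (sq_nonneg _) (cutoff_nonneg _))) ?_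
      (ae_of_all _ fun x => ?_)
    · refine Continuous.integrable_of_hasCompactSupport ((hQ.continuous_trunc R).pow 2) ?_
      exact (hasCompactSupport_trunc Q R).comp_left (g := fun t : ℝ => t ^ 2) (by simp)
    · simp only [norm_smul, Real.norm_of_nonneg hR0.le]
      by_cases hx : ‖x‖ ≤ 1
      · have h1 := trunc_sq_le (Q := Q) 1 (R • x)
        have hc : cutoff (2 * (R * ‖x‖)) ≤ 1 := cutoff_le_one _
        rw [one_smul, one_pow, one_mul] at h1
        have hx' : trunc Q R x ^ 2 = R ^ 2 * Q (R • x) ^ 2 := by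
          rw [trunc, cutoff_eq_one (by rwa [abs_norm])]
          ring
        rw [hx']
        have := mul_le_mul h1 hc (cutoff_nonneg _) (sq_nonneg _)
        rw [mul_one] at this
        exact mul_le_mul_of_nonneg_left this (sq_nonneg R)
      · have hx1 : 1 < ‖x‖ := not_le.1 hx
        have h2 : 1 ≤ R * ‖x‖ := by nlinarith
        rw [cutoff_eq_zero (by nlinarith : 2 ≤ (2 * (R * ‖x‖)) ^ 2)]
        simpa using sq_nonneg (trunc Q R x)

theorem trunc_eq_radial (hQ : IsGroundState Q) {R : ℝ} (hR : 0 < R) (x : Plane) :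
    trunc Q R x = R * Q ((R * ‖x‖) • e0) * cutoff ‖x‖ := by
  rw [trunc, hQ.eq_norm (R • x), norm_smul, Real.norm_of_nonneg hR.le]

theorem gradSq_trunc_ae (hQ : IsGroundState Q) {R : ℝ} (hR : 0 < R) (s : ℝ) :
    gradSq (fun x => ((s * trunc Q R x : ℝ) : ℂ)) =ᵐ[volume] fun x =>
      s ^ 2 * truncDeriv (fun r => Q (r • e0)) (fun r => d0R Q (r • e0)) R ‖x‖ ^ 2 := by
  have hne : ∀ᵐ x : Plane, x ≠ 0 := by simp [ae_iff]
  filter_upwards [hne] with x hx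
  rw [gradSq_ofReal_radial (W := fun x => s * trunc Q R x)
    ((differentiable_trunc hQ.differentiable R).const_mul s)
    (k := fun r => s * (R * Q ((R * r) • e0) * cutoff r))
    (fun x => by rw [hQ.trunc_eq_radial hR]) hx
    ((hQ.isProfile.hasDerivAt_trunc R ‖x‖).const_mul s), mul_pow]

theorem integrable_truncDeriv_sq (hQ : IsGroundState Q) (R : ℝ) :
    Integrable fun x : Plane =>
      truncDeriv (fun r => Q (r • e0)) (fun r => d0R Q (r • e0)) R ‖x‖ ^ 2 := by
  refine Continuous.integrable_of_hasCompactSupport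
    (((hQ.isProfile.continuous_truncDeriv R).comp continuous_norm).pow 2)
    (HasCompactSupport.of_support_subset_isCompact (isCompact_closedBall 0 2) fun x hx => ?_)
  by_contra hout
  simp only [mem_closedBall, dist_zero_right, not_le] at hout
  refine hx ?_
  simp [truncDeriv, cutoff_eq_zero (by nlinarith : 2 ≤ ‖x‖ ^ 2),
    deriv_cutoff_eq_zero_of_two_lt hout]

/-- The kinetic minus quartic energy of multiples of truncated rescaled ground states stays bounded,
uniformly in the scale. -/
theorem exists_energy_trunc_le (hQ : IsGroundState Q) :
    ∃ C r₀ : ℝ, 1 ≤ r₀ ∧ ∀ R s, r₀ ≤ R → 1 ≤ s ^ 2 →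
      (∫ x, gradSq (fun x => ((s * trunc Q R x : ℝ) : ℂ)) x)
        - 1 / 2 * (∫ x, ‖((s * trunc Q R x : ℝ) : ℂ)‖ ^ 4) ≤ s ^ 2 * C := by
  obtain ⟨C, r₀, h0, hC⟩ := hQ.isProfile.exists_trunc_energy_le
  refine ⟨radialConst * C, r₀, h0, fun R s hR hs => ?_⟩
  have hR0 : 0 < R := by linarith
  set k' := truncDeriv (fun r => Q (r • e0)) (fun r => d0R Q (r • e0)) R
  have i4 : Integrable fun x => trunc Q R x ^ 4 :=
    Continuous.integrable_of_hasCompactSupport ((hQ.continuous_trunc R).pow 4)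
      ((hasCompactSupport_trunc Q R).comp_left (g := fun t : ℝ => t ^ 4) (by simp))
  have i1 : Integrable fun x : Plane => k' ‖x‖ ^ 2 := hQ.integrable_truncDeriv_sq R
  have h4 : ∫ x, ‖((s * trunc Q R x : ℝ) : ℂ)‖ ^ 4 = (s ^ 2) ^ 2 * ∫ x, trunc Q R x ^ 4 := by
    rw [← integral_const_mul]
    refine integral_congr_ae (ae_of_all _ fun x => ?_)
    simp only [Complex.norm_real, Real.norm_eq_abs]
    rw [show (4 : ℕ) = 2 * 2 from rfl, pow_mul, sq_abs]
    ring
  have hrad : (∫ x : Plane, k' ‖x‖ ^ 2) - 1 / 2 * (∫ x, trunc Q R x ^ 4)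
      = radialConst * ∫ r in Ioi (0 : ℝ),
          r * (k' r ^ 2 - (R * Q ((R * r) • e0) * cutoff r) ^ 4 / 2) := by
    rw [← integral_radial, ← integral_const_mul, ← integral_sub i1 (i4.const_mul _)]
    refine integral_congr_ae (ae_of_all _ fun x => ?_)
    simp only [hQ.trunc_eq_radial hR0]
    ring
  have hmain := mul_le_mul_of_nonneg_left (hC R hR) radialConst_nonneg
  rw [← hrad] at hmain
  have hpos : 0 ≤ ∫ x, trunc Q R x ^ 4 := integral_nonneg fun x => by positivity
  rw [integral_congr_ae (hQ.gradSq_trunc_ae hR0 s), integral_const_mul, h4]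
  have h1 := mul_le_mul_of_nonneg_left hmain (sq_nonneg s)
  have h2 : s ^ 2 * (∫ x, trunc Q R x ^ 4) ≤ (s ^ 2) ^ 2 * ∫ x, trunc Q R x ^ 4 :=
    mul_le_mul_of_nonneg_right (by nlinarith) hpos
  linarith

/-- The energy is unbounded below at and above the critical mass. -/
theorem exists_Ea_lt (hQ : IsGroundState Q) {V : Plane → ℝ} (hV : V110 V) (Ω : ℝ) {a : ℝ}
    (ha : (∫ x : Plane, Q x ^ 2) ≤ a) (E : ℝ) : ∃ v ∈ Sset V a, Ea V Ω v < E := by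
  obtain ⟨C, r₀, h0, hC⟩ := hQ.exists_energy_trunc_le
  obtain ⟨n, hn, hnle⟩ := hQ.exists_pos_le_integral_trunc_sq
  obtain ⟨hVm, hV0, hVloc, -⟩ := hV
  obtain ⟨B, hB⟩ := hVloc 2
  set T := ∫ x, ‖x‖ * Q x ^ 2
  have hT : 0 ≤ T := integral_nonneg fun x => by positivity
  have han : n ≤ a := (hnle 1 le_rfl).trans ((hQ.integral_trunc_sq_le one_pos).trans ha)
  have ha0 : 0 < a := hn.trans_le han
  set D := a / n * (|C| + a * T) + B * a
  obtain ⟨R, hR0, hRlog⟩ : ∃ R, r₀ ≤ R ∧ 2 * (D - E) / a ^ 2 < Real.log R :=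
    ((eventually_ge_atTop r₀).and (Real.tendsto_log_atTop.eventually_gt_atTop _)).exists
  have hR1 : 1 ≤ R := h0.trans hR0
  have hRpos : 0 < R := by linarith
  set N := ∫ x, trunc Q R x ^ 2 with hN
  have hnN : n ≤ N := hnle R hR1
  have hN0 : 0 < N := hn.trans_le hnN
  have hNa : N ≤ a := (hQ.integral_trunc_sq_le hRpos).trans ha
  set s := √(a / N) with hs
  have hs2 : s ^ 2 = a / N := Real.sq_sqrt (by positivity)
  have hs1 : 1 ≤ s ^ 2 := by rw [hs2, one_le_div hN0]; exact hNa
  have hsn : s ^ 2 ≤ a / n := by rw [hs2]; gcongr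
  set W : Plane → ℝ := fun x => s * trunc Q R x with hW
  have hWd : Differentiable ℝ W := (differentiable_trunc hQ.differentiable R).const_mul s
  have hWc : Continuous W := hWd.continuous
  have hWs : HasCompactSupport W := (hasCompactSupport_trunc Q R).mul_left
  set u : Plane → ℂ := fun x => (W x : ℂ) with hu
  have hud : Differentiable ℝ u := Complex.ofRealCLM.differentiable.comp hWd
  have hus : HasCompactSupport u := hWs.comp_left Complex.ofReal_zero
  have hnorm : ∀ x, ‖u x‖ ^ 2 = s ^ 2 * trunc Q R x ^ 2 := fun x => by
    simp only [hu, hW, Complex.norm_real, Real.norm_eq_abs, sq_abs, mul_pow]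
  have hu2 : Continuous fun x => ‖u x‖ ^ 2 := hud.continuous.norm.pow 2
  have i2 : Integrable fun x => ‖u x‖ ^ 2 :=
    hu2.integrable_of_hasCompactSupport (hus.comp_left (g := fun z : ℂ => ‖z‖ ^ 2) (by simp))
  have mass : ∫ x, ‖u x‖ ^ 2 = a := by
    simp only [hnorm]
    rw [integral_const_mul, ← hN, hs2, div_mul_cancel₀ _ hN0.ne']
  have moment : R * ∫ x, ‖x‖ * ‖u x‖ ^ 2 ≤ s ^ 2 * T := by
    have h1 : ∫ x, ‖x‖ * ‖u x‖ ^ 2 = s ^ 2 * ∫ x, ‖x‖ * trunc Q R x ^ 2 := by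
      rw [← integral_const_mul]
      refine integral_congr_ae (ae_of_all _ fun x => ?_)
      simp only [hnorm]
      ring
    have h2 := mul_le_mul_of_nonneg_left (hQ.integral_norm_mul_trunc_sq_le hRpos) (sq_nonneg s)
    rw [h1]
    linarith
  have hVle : ∀ x, V x * ‖u x‖ ^ 2 ≤ B * ‖u x‖ ^ 2 := fun x => by
    rcases le_or_gt ‖x‖ 2 with hx | hx
    · exact mul_le_mul_of_nonneg_right (hB x hx) (sq_nonneg _)
    · simp [hnorm, trunc_eq_zero Q R hx.le]
  have iV : Integrable fun x => V x * ‖u x‖ ^ 2 := by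
    refine (i2.const_mul B).mono' (hVm.mul hu2.measurable).aestronglyMeasurable
      (ae_of_all _ fun x => ?_)
    rw [Real.norm_of_nonneg (mul_nonneg (hV0 x) (sq_nonneg _))]
    exact hVle x
  have iG : Integrable (gradSq u) :=
    ((hQ.integrable_truncDeriv_sq R).const_mul (s ^ 2)).congr (hQ.gradSq_trunc_ae hRpos s).symm
  refine ⟨u, ⟨⟨⟨hud, i2, iG⟩, iV⟩, mass⟩, ?_⟩
  have hpot : ∫ x, V x * ‖u x‖ ^ 2 ≤ B * a := by
    rw [← mass, ← integral_const_mul]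
    exact integral_mono iV (i2.const_mul B) hVle
  have hlog := logConv_le hud.continuous hus hRpos
  rw [mass] at hlog
  have hen := hC R s hR0 hs1
  have hmom : ∫ x, momentum u x = 0 := by simp [hu, momentum_ofReal hWd]
  rw [Ea, integral_add iG iV, hmom]
  have h1 := mul_le_mul_of_nonneg_left moment ha0.le
  have h2 : s ^ 2 * C ≤ a / n * |C| :=
    (mul_le_mul_of_nonneg_left (le_abs_self C) (sq_nonneg s)).trans
      (mul_le_mul_of_nonneg_right hsn (abs_nonneg C))
  have h3 : s ^ 2 * (a * T) ≤ a / n * (a * T) := mul_le_mul_of_nonneg_right hsn (by positivity)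
  rw [div_lt_iff₀ (by positivity)] at hRlog
  simp only [D] at hRlog
  linarith

end IsGroundState

theorem nonexistence_supercritical_mass
    (V : Plane → ℝ) (hV : V110 V) (Ω : ℝ) (hΩ0 : 0 ≤ Ω) (hΩ : SubCritical V Ω)
    (Q : Plane → ℝ) (hQ : IsGroundState Q)
    (a : ℝ) (ha : (∫ x : Plane, (Q x) ^ 2) ≤ a) :
    ¬ ∃ u, IsMinimizer V Ω a u := by
  rintro ⟨u, -, hmin⟩
  obtain ⟨v, hv, hlt⟩ := hQ.exists_Ea_lt hV Ω ha (Ea V Ω u)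
  exact (hmin v hv).not_gt hlt

end
end

section
/- For every u ∈ X one has ∫_{ℝ²}∫_{ℝ²} ln|x−y| u²(x) u²(y) dx dy ≤ 2‖u‖_*² ‖u‖₂² + C ‖u‖_{8/3}⁴, where C > 0 is a universal constant, ‖u‖_* = (∫_{ℝ²} ln(1+|x|)|u|² dx)^{1/2}, and ‖u‖_{8/3} is the L^{8/3}(ℝ²) norm. -/
open MeasureTheory Filter Topology Set Metric

noncomputable section

/-- Membership in `H¹(ℝ², ℝ)`. -/
def InH1R (q : Plane → ℝ) : Prop :=
  Differentiable ℝ q ∧ Integrable (fun x => (q x) ^ 2) ∧ Integrable (fun x => ‖fderiv ℝ q x‖ ^ 2)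

/-- Membership in `X = {u ∈ H¹(ℝ²,ℝ) : ∫ ln(1+|x|)|u|² < ∞}`. -/
def InX (q : Plane → ℝ) : Prop :=
  InH1R q ∧ Integrable (fun x => Real.log (1 + ‖x‖) * (q x) ^ 2)

/-- A nonnegative integrable function dominating `f` bounds the Bochner integral of `f`,
whether or not `f` is integrable. -/
theorem integral_le_integral_of_le_of_nonneg {α : Type*} [MeasurableSpace α] {μ : Measure α}
    {f g : α → ℝ} (hg : Integrable g μ) (hg0 : ∀ x, 0 ≤ g x) (hfg : ∀ x, f x ≤ g x) :
    ∫ x, f x ∂μ ≤ ∫ x, g x ∂μ := by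
  by_cases hf : Integrable f μ
  · exact integral_mono hf hg hfg
  · rw [integral_undef hf]
    exact integral_nonneg hg0

theorem log_one_add_norm_nonneg {E : Type*} [SeminormedAddCommGroup E] (x : E) :
    0 ≤ Real.log (1 + ‖x‖) :=
  Real.log_nonneg (le_add_of_nonneg_right (norm_nonneg x))

theorem log_norm_sub_le {E : Type*} [SeminormedAddCommGroup E] (x y : E) :
    Real.log ‖x - y‖ ≤ Real.log (1 + ‖x‖) + Real.log (1 + ‖y‖) := by
  rcases (norm_nonneg (x - y)).eq_or_lt with h | h
  · rw [← h, Real.log_zero]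
    exact add_nonneg (log_one_add_norm_nonneg x) (log_one_add_norm_nonneg y)
  · rw [← Real.log_mul (by positivity) (by positivity)]
    refine Real.log_le_log h ((norm_sub_le x y).trans ?_)
    nlinarith [mul_nonneg (norm_nonneg x) (norm_nonneg y)]

/-- The logarithmic convolution of a nonnegative density `ρ` is at most twice the product of its
logarithmic moment and its mass. -/
theorem integral_log_norm_sub_le {E : Type*} [SeminormedAddCommGroup E] [MeasurableSpace E]
    {μ : Measure E} {ρ : E → ℝ} (hρ0 : ∀ x, 0 ≤ ρ x) (hρ : Integrable ρ μ)
    (hlog : Integrable (fun x => Real.log (1 + ‖x‖) * ρ x) μ) :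
    ∫ x, ∫ y, Real.log ‖x - y‖ * ρ x * ρ y ∂μ ∂μ ≤
      2 * (∫ x, Real.log (1 + ‖x‖) * ρ x ∂μ) * ∫ x, ρ x ∂μ := by
  set A := ∫ x, Real.log (1 + ‖x‖) * ρ x ∂μ
  set B := ∫ x, ρ x ∂μ
  have hlog0 : ∀ x, 0 ≤ Real.log (1 + ‖x‖) * ρ x := fun x =>
    mul_nonneg (log_one_add_norm_nonneg x) (hρ0 x)
  have hA : 0 ≤ A := integral_nonneg hlog0
  have hB : 0 ≤ B := integral_nonneg hρ0
  have inner_le : ∀ x, ∫ y, Real.log ‖x - y‖ * ρ x * ρ y ∂μ ≤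
      (Real.log (1 + ‖x‖) * ρ x) * B + ρ x * A := by
    intro x
    have h1 := hρ.const_mul (Real.log (1 + ‖x‖) * ρ x)
    have h2 := hlog.const_mul (ρ x)
    refine (integral_le_integral_of_le_of_nonneg (h1.add h2) (fun y => add_nonneg
      (mul_nonneg (hlog0 x) (hρ0 y)) (mul_nonneg (hρ0 x) (hlog0 y))) fun y => ?_).trans_eq ?_
    · have := mul_le_mul_of_nonneg_right (log_norm_sub_le x y) (mul_nonneg (hρ0 x) (hρ0 y))
      simp only [Pi.add_apply]
      linarith
    · simp only [Pi.add_apply]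
      rw [integral_add h1 h2, integral_const_mul, integral_const_mul]
  have h1 := hlog.mul_const B
  have h2 := hρ.mul_const A
  refine (integral_le_integral_of_le_of_nonneg (h1.add h2) (fun x => add_nonneg
    (mul_nonneg (hlog0 x) hB) (mul_nonneg (hρ0 x) hA)) inner_le).trans_eq ?_
  simp only [Pi.add_apply]
  rw [integral_add h1 h2, integral_mul_const, integral_mul_const]
  ring

theorem logConv_upper_bound :
    ∃ C : ℝ, 0 < C ∧ ∀ q : Plane → ℝ, InX q →
      (∫ x : Plane, ∫ y : Plane, Real.log ‖x - y‖ * (q x) ^ 2 * (q y) ^ 2) ≤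
        2 * (∫ x : Plane, Real.log (1 + ‖x‖) * (q x) ^ 2) * (∫ x : Plane, (q x) ^ 2)
          + C * (∫ x : Plane, |q x| ^ ((8 : ℝ) / 3)) ^ ((3 : ℝ) / 2) := by
  refine ⟨1, one_pos, fun q ⟨⟨_, hq, _⟩, hlog⟩ => ?_⟩
  refine (integral_log_norm_sub_le (fun x => sq_nonneg (q x)) hq hlog).trans
    (le_add_of_nonneg_right ?_)
  positivity

end
end

section
/- Let a > 0 and let u ∈ H¹(ℝ²,ℂ) with ∫_{ℝ²}|u|² dx = a. Then there is a universal constant C > 0 such that ∫_{ℝ²}∫_{ℝ²} ln(1 + 1/|x−y|) |u(x)|²|u(y)|² dx dy ≤ ∫_{ℝ²}∫_{ℝ²} |u(x)|²|u(y)|²/|x−y| dx dy ≤ C a^{3/2} (∫_{ℝ²} |∇|u||² dx)^{1/2}. -/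
open MeasureTheory Filter Topology Set Metric

noncomputable section

/-- One-dimensional integration by parts for the measure `r dr` on the half-line. -/
theorem lintegral_Ioi_le_lintegral_mul_deriv {h h' : ℝ → ℝ}
    (hd : ∀ r, HasDerivAt h (h' r) r) (h0 : ∀ r, 0 ≤ h r)
    (hfin : ∫⁻ r in Ioi (0 : ℝ), ENNReal.ofReal r * ENNReal.ofReal (h r) ≠ ⊤) :
    ∫⁻ r in Ioi (0 : ℝ), ENNReal.ofReal (h r) ≤
      ∫⁻ r in Ioi (0 : ℝ), ENNReal.ofReal r * ‖h' r‖ₑ := by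
  by_cases htop : ∫⁻ r in Ioi (0 : ℝ), ENNReal.ofReal r * ‖h' r‖ₑ = ⊤
  · simp [htop]
  have hc : Continuous h := continuous_iff_continuousAt.2 fun r => (hd r).continuousAt
  have hm' : Measurable h' := by
    have : h' = deriv h := funext fun r => (hd r).deriv.symm
    rw [this]; exact measurable_deriv h
  have hrh : IntegrableOn (fun r => r * h r) (Ioi 0) := by
    refine ⟨(continuous_id.mul hc).aestronglyMeasurable, ?_⟩
    refine lt_of_le_of_lt (le_of_eq ?_) (lt_top_iff_ne_top.2 hfin)
    refine setLIntegral_congr_fun measurableSet_Ioi fun r hr => ?_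
    simp only [enorm_mul, Real.enorm_of_nonneg (le_of_lt (mem_Ioi.1 hr)),
      Real.enorm_of_nonneg (h0 r)]
  have hrh' : IntegrableOn (fun r => r * h' r) (Ioi 0) := by
    refine ⟨(measurable_id.mul hm').aestronglyMeasurable, ?_⟩
    refine lt_of_le_of_lt (le_of_eq ?_) (lt_top_iff_ne_top.2 htop)
    refine setLIntegral_congr_fun measurableSet_Ioi fun r hr => ?_
    simp only [enorm_mul, Real.enorm_of_nonneg (le_of_lt (mem_Ioi.1 hr))]
  have hi : IntegrableOn h (Ioi 0) := by
    rw [← Ioc_union_Ioi_eq_Ioi (zero_le_one' ℝ)]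
    refine IntegrableOn.union ?_ ?_
    · exact (hc.integrableOn_Icc (a := 0) (b := 1)).mono_set Ioc_subset_Icc_self
    · refine Integrable.mono' (hrh.mono_set (Ioi_subset_Ioi (zero_le_one' ℝ)))
        hc.aestronglyMeasurable ?_
      refine (ae_restrict_iff' measurableSet_Ioi).2 (Eventually.of_forall fun r hr => ?_)
      rw [Real.norm_of_nonneg (h0 r)]
      exact le_mul_of_one_le_left (h0 r) (le_of_lt hr)
  have hder : ∀ r, HasDerivAt (fun r => r * h r) (h r + r * h' r) r := fun r => by
    simpa using (hasDerivAt_id' r).fun_mul (hd r)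
  have hlim := tendsto_zero_of_hasDerivAt_of_integrableOn_Ioi (fun r _ => hder r)
    (hi.add hrh') hrh
  have hint := integral_Ioi_of_hasDerivAt_of_tendsto' (fun r _ => hder r) (hi.add hrh') hlim
  rw [integral_add hi hrh'] at hint
  rw [← ofReal_integral_eq_lintegral_ofReal hi (Eventually.of_forall h0)]
  have hle : ∫ r in Ioi (0 : ℝ), h r ≤ ‖∫ r in Ioi (0 : ℝ), r * h' r‖ := by
    refine le_trans ?_ (neg_le_abs _)
    linarith
  calc ENNReal.ofReal (∫ r in Ioi (0 : ℝ), h r)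
      ≤ ‖∫ r in Ioi (0 : ℝ), r * h' r‖ₑ := by
        rw [← ofReal_norm]; exact ENNReal.ofReal_le_ofReal hle
    _ ≤ ∫⁻ r in Ioi (0 : ℝ), ‖r * h' r‖ₑ := enorm_integral_le_lintegral_enorm _
    _ = _ := by
        refine setLIntegral_congr_fun measurableSet_Ioi fun r hr => ?_
        simp only [enorm_mul, Real.enorm_of_nonneg (le_of_lt (mem_Ioi.1 hr))]

/-- The unit vector of the plane with polar angle `θ`. -/
def unitDir (θ : ℝ) : Plane :=
  Complex.orthonormalBasisOneI.repr (Real.cos θ + Real.sin θ * Complex.I)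

theorem norm_unitDir (θ : ℝ) : ‖unitDir θ‖ = 1 := by
  rw [unitDir, LinearIsometryEquiv.norm_map, Complex.ofReal_cos, Complex.ofReal_sin,
    Complex.cos_add_sin_I, Complex.norm_exp_ofReal_mul_I]

theorem continuous_unitDir : Continuous unitDir := by
  unfold unitDir
  fun_prop

theorem lintegral_plane_polar {F : Plane → ENNReal} (hF : Measurable F) :
    ∫⁻ z, F z = ∫⁻ θ in Ioo (-Real.pi) Real.pi, ∫⁻ r in Ioi (0 : ℝ),
      ENNReal.ofReal r * F (r • unitDir θ) := by
  rw [← (Complex.orthonormalBasisOneI.repr.measurePreserving).lintegral_comp hF,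
    ← Complex.lintegral_comp_polarCoord_symm, polarCoord_target,
    Measure.volume_eq_prod, ← Measure.prod_restrict]
  have hpt : ∀ p : ℝ × ℝ, Complex.orthonormalBasisOneI.repr (Complex.polarCoord.symm p) =
      p.1 • unitDir p.2 := fun p => by
    rw [Complex.polarCoord_symm_apply, unitDir, ← map_smul, Complex.real_smul]
  simp only [hpt, smul_eq_mul]
  rw [lintegral_prod_symm]
  have : Measurable fun p : ℝ × ℝ => p.1 • unitDir p.2 :=
    (continuous_fst.smul (continuous_unitDir.comp continuous_snd)).measurable
  exact ((ENNReal.measurable_ofReal.comp measurable_fst).mul (hF.comp this)).aemeasurable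

/-- Hardy-type inequality in the plane: since `div (z / |z|) = 1 / |z|`, the Riesz potential
of a nonnegative `g` is bounded by the total variation of `g`. -/
theorem lintegral_div_norm_sub_le {g : Plane → ℝ} (hg : Differentiable ℝ g)
    (g0 : ∀ x, 0 ≤ g x) (hi : Integrable g) (x : Plane) :
    ∫⁻ y, ENNReal.ofReal (g y / ‖x - y‖) ≤ ∫⁻ y, ‖fderiv ℝ g y‖ₑ := by
  have hgm : Measurable g := hg.continuous.measurable
  have hDm : Measurable fun y => ‖fderiv ℝ g y‖ₑ := (measurable_fderiv ℝ g).enorm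
  rw [← lintegral_add_left_eq_self (fun y => ENNReal.ofReal (g y / ‖x - y‖)) x,
    ← lintegral_add_left_eq_self (fun y => ‖fderiv ℝ g y‖ₑ) x]
  have hxm : Measurable fun z : Plane => x + z := measurable_const_add x
  have hfin : ∫⁻ z, ENNReal.ofReal (g (x + z)) ≠ ⊤ := by
    rw [lintegral_add_left_eq_self (fun y => ENNReal.ofReal (g y)) x]
    exact (hi.lintegral_lt_top).ne
  have hFm : Measurable fun z => ENNReal.ofReal (g (x + z)) :=
    ENNReal.measurable_ofReal.comp (hgm.comp hxm)
  rw [lintegral_plane_polar hFm] at hfin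
  have hae := ae_lt_top' (by
    refine Measurable.aemeasurable ?_
    refine Measurable.lintegral_prod_left' (f := fun p : ℝ × ℝ =>
      ENNReal.ofReal p.1 * ENNReal.ofReal (g (x + p.1 • unitDir p.2))) ?_
    have : Measurable fun p : ℝ × ℝ => p.1 • unitDir p.2 :=
      (continuous_fst.smul (continuous_unitDir.comp continuous_snd)).measurable
    exact (ENNReal.measurable_ofReal.comp measurable_fst).mul (hFm.comp this)) hfin
  rw [lintegral_plane_polar (by
      have : Measurable fun z : Plane => ‖x - (x + z)‖ := by fun_prop
      exact ENNReal.measurable_ofReal.comp ((hgm.comp hxm).div this)),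
    lintegral_plane_polar (F := fun z => ‖fderiv ℝ g (x + z)‖ₑ) (hDm.comp hxm)]
  refine lintegral_mono_ae (hae.mono fun θ hθ => ?_)
  have hd : ∀ r : ℝ, HasDerivAt (fun r : ℝ => g (x + r • unitDir θ))
      (fderiv ℝ g (x + r • unitDir θ) (unitDir θ)) r := fun r => by
    refine (hg _).hasFDerivAt.comp_hasDerivAt r ?_
    simpa using ((hasDerivAt_id r).smul_const (unitDir θ)).const_add x
  calc _ = ∫⁻ r in Ioi (0 : ℝ), ENNReal.ofReal (g (x + r • unitDir θ)) := by
        refine setLIntegral_congr_fun measurableSet_Ioi fun r hr => ?_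
        have hr0 : (0 : ℝ) < r := hr
        have hn : ‖x - (x + r • unitDir θ)‖ = r := by
          rw [sub_add_cancel_left, norm_neg, norm_smul, norm_unitDir, mul_one,
            Real.norm_of_nonneg hr0.le]
        simp only [hn]
        rw [← ENNReal.ofReal_mul hr0.le, mul_div_cancel₀ _ hr0.ne']
    _ ≤ ∫⁻ r in Ioi (0 : ℝ), ENNReal.ofReal r *
          ‖fderiv ℝ g (x + r • unitDir θ) (unitDir θ)‖ₑ :=
        lintegral_Ioi_le_lintegral_mul_deriv hd (fun r => g0 _) hθ.ne
    _ ≤ _ := by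
        refine lintegral_mono fun r => ?_
        gcongr
        rw [← ofReal_norm, ← ofReal_norm]
        refine ENNReal.ofReal_le_ofReal ?_
        simpa [norm_unitDir] using
          (fderiv ℝ g (x + r • unitDir θ)).le_opNorm (unitDir θ)

theorem norm_fderiv_norm_sq_le {u : Plane → ℂ} (hu : Differentiable ℝ u) (x : Plane) :
    ‖fderiv ℝ (fun y => ‖u y‖ ^ 2) x‖ ≤
      2 * (‖u x‖ * ‖fderiv ℝ (fun y => ‖u y‖) x‖) := by
  by_cases hx : u x = 0
  · have := (hu x).hasFDerivAt.norm_sq.fderiv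
    rw [this]
    simp [hx]
  · have hd : DifferentiableAt ℝ (fun y => ‖u y‖) x := (hu x).norm ℝ hx
    have := (hd.hasFDerivAt.pow 2).fderiv
    rw [this]
    simp [norm_smul, mul_assoc]

theorem norm_fderiv_norm_le {u : Plane → ℂ} (hu : Differentiable ℝ u) (x : Plane) :
    ‖fderiv ℝ (fun y => ‖u y‖) x‖ ≤ ‖fderiv ℝ u x‖ := by
  by_cases hd : DifferentiableAt ℝ (fun y => ‖u y‖) x
  · refine le_of_forall_pos_le_add fun ε hε => ?_
    refine hd.hasFDerivAt.le_of_lip' (by positivity) ?_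
    filter_upwards [(hu x).hasFDerivAt.isLittleO.def hε] with y hy
    calc ‖‖u y‖ - ‖u x‖‖ ≤ ‖u y - u x‖ := abs_norm_sub_norm_le _ _
      _ ≤ ‖fderiv ℝ u x (y - x)‖ + ‖u y - u x - fderiv ℝ u x (y - x)‖ := norm_le_insert' _ _
      _ ≤ ‖fderiv ℝ u x‖ * ‖y - x‖ + ε * ‖y - x‖ :=
          add_le_add (ContinuousLinearMap.le_opNorm _ _) hy
      _ = (‖fderiv ℝ u x‖ + ε) * ‖y - x‖ := by ring
  · rw [fderiv_zero_of_not_differentiableAt hd]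
    simp

theorem norm_fderiv_sq_le_gradSq (u : Plane → ℂ) (x : Plane) :
    ‖fderiv ℝ u x‖ ^ 2 ≤ gradSq u x := by
  have h0 : 0 ≤ gradSq u x := by unfold gradSq; positivity
  refine (Real.le_sqrt (norm_nonneg _) h0).1 ?_
  refine ContinuousLinearMap.opNorm_le_bound _ (Real.sqrt_nonneg _) fun v => ?_
  have hv : v = v 0 • e0 + v 1 • e1 := by
    ext i; fin_cases i <;> simp [e0, e1]
  have h1 : ‖fderiv ℝ u x v‖ ≤ |v 0| * ‖d0 u x‖ + |v 1| * ‖d1 u x‖ := by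
    conv_lhs => rw [hv, map_add, map_smul, map_smul]
    refine (norm_add_le _ _).trans (le_of_eq ?_)
    rw [norm_smul, norm_smul]; rfl
  refine h1.trans ?_
  rw [EuclideanSpace.norm_eq, Fin.sum_univ_two, ← Real.sqrt_mul h0]
  refine Real.le_sqrt_of_sq_le ?_
  simp only [gradSq, Real.norm_eq_abs]
  nlinarith [sq_nonneg (|v 0| * ‖d1 u x‖ - |v 1| * ‖d0 u x‖)]

theorem InH1.integrable_gradAbsSq {u : Plane → ℂ} (hu : InH1 u) :
    Integrable (gradAbsSq u) := by
  refine hu.2.2.mono' ?_ (Eventually.of_forall fun x => ?_)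
  · exact ((measurable_fderiv ℝ (fun y => ‖u y‖)).norm.pow_const 2).aestronglyMeasurable
  · have : 0 ≤ gradAbsSq u x := by unfold gradAbsSq; positivity
    rw [Real.norm_of_nonneg this]
    refine le_trans ?_ (norm_fderiv_sq_le_gradSq u x)
    exact pow_le_pow_left₀ (norm_nonneg _) (norm_fderiv_norm_le hu.1 x) 2

theorem InH1.lintegral_potential_le {u : Plane → ℂ} (hu : InH1 u) (x : Plane) :
    ∫⁻ y, ENNReal.ofReal (‖u y‖ ^ 2 / ‖x - y‖) ≤
      ENNReal.ofReal (2 * (Real.sqrt (∫ y, ‖u y‖ ^ 2) * Real.sqrt (∫ y, gradAbsSq u y))) := by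
  set D : Plane → ℝ := fun y => ‖fderiv ℝ (fun z => ‖u z‖) y‖ with hD
  have hDm : AEStronglyMeasurable D volume :=
    (measurable_fderiv ℝ (fun y => ‖u y‖)).norm.aestronglyMeasurable
  have hum : AEStronglyMeasurable (fun y => ‖u y‖) volume :=
    hu.1.continuous.norm.aestronglyMeasurable
  have hu2 : MemLp (fun y => ‖u y‖) 2 volume := (memLp_two_iff_integrable_sq hum).2 hu.2.1
  have hD2 : MemLp D 2 volume := (memLp_two_iff_integrable_sq hDm).2 hu.integrable_gradAbsSq
  have hprod : Integrable fun y => 2 * (‖u y‖ * D y) := (hu2.integrable_mul hD2).const_mul 2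
  have hcs := integral_mul_le_Lp_mul_Lq_of_nonneg Real.HolderConjugate.two_two
    (μ := volume) (f := fun y => ‖u y‖) (g := D)
    (Eventually.of_forall fun y => norm_nonneg _) (Eventually.of_forall fun y => norm_nonneg _)
    (by simpa using hu2) (by simpa using hD2)
  simp only [Real.rpow_two, ← Real.sqrt_eq_rpow] at hcs
  calc _ ≤ ∫⁻ y, ‖fderiv ℝ (fun z => ‖u z‖ ^ 2) y‖ₑ :=
        lintegral_div_norm_sub_le (hu.1.norm_sq ℝ) (fun y => by positivity) hu.2.1 x
    _ ≤ ∫⁻ y, ENNReal.ofReal (2 * (‖u y‖ * D y)) := by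
        refine lintegral_mono fun y => ?_
        rw [← ofReal_norm]
        exact ENNReal.ofReal_le_ofReal (norm_fderiv_norm_sq_le hu.1 y)
    _ = ENNReal.ofReal (∫ y, 2 * (‖u y‖ * D y)) :=
        (ofReal_integral_eq_lintegral_ofReal hprod
          (Eventually.of_forall fun y => by simp only [hD, Pi.zero_apply]; positivity)).symm
    _ ≤ _ := by
        refine ENNReal.ofReal_le_ofReal ?_
        rw [integral_const_mul]
        exact mul_le_mul_of_nonneg_left hcs zero_le_two

theorem hls_log_bound :
    ∃ C : ℝ, 0 < C ∧ ∀ a : ℝ, 0 < a → ∀ u : Plane → ℂ, InH1 u →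
      (∫ x : Plane, ‖u x‖ ^ 2) = a →
      (∫ x : Plane, ∫ y : Plane, Real.log (1 + 1 / ‖x - y‖) * ‖u x‖ ^ 2 * ‖u y‖ ^ 2) ≤
          (∫ x : Plane, ∫ y : Plane, ‖u x‖ ^ 2 * ‖u y‖ ^ 2 / ‖x - y‖) ∧
      (∫ x : Plane, ∫ y : Plane, ‖u x‖ ^ 2 * ‖u y‖ ^ 2 / ‖x - y‖) ≤
          C * a ^ ((3 : ℝ) / 2) * Real.sqrt (∫ x : Plane, gradAbsSq u x) := by
  refine ⟨2, two_pos, fun a ha u hu hua => ?_⟩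
  set K : ℝ := 2 * (Real.sqrt a * Real.sqrt (∫ y, gradAbsSq u y)) with hK
  have hK0 : 0 ≤ K := by positivity
  have hcu : Continuous u := hu.1.continuous
  have hpos : ∀ x y : Plane, 0 ≤ ‖u y‖ ^ 2 / ‖x - y‖ := fun x y => by positivity
  have hmeas : Measurable fun p : Plane × Plane => ‖u p.2‖ ^ 2 / ‖p.1 - p.2‖ := by
    have := hcu.measurable
    fun_prop
  have hlin : ∀ x : Plane, ∫⁻ y, ENNReal.ofReal (‖u y‖ ^ 2 / ‖x - y‖) ≤ ENNReal.ofReal K :=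
    fun x => by simpa only [hua] using hu.lintegral_potential_le x
  have hmx : ∀ x : Plane, AEStronglyMeasurable (fun y => ‖u y‖ ^ 2 / ‖x - y‖) volume :=
    fun x => (hmeas.comp measurable_prodMk_left).aestronglyMeasurable
  have hint : ∀ x : Plane, Integrable fun y => ‖u y‖ ^ 2 / ‖x - y‖ := fun x => by
    refine (lintegral_ofReal_ne_top_iff_integrable (hmx x)
      (Eventually.of_forall (hpos x))).1 ?_
    exact ne_top_of_le_ne_top ENNReal.ofReal_ne_top (hlin x)
  set J : Plane → ℝ := fun x => ∫ y, ‖u y‖ ^ 2 / ‖x - y‖ with hJ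
  have hJ0 : ∀ x, 0 ≤ J x := fun x => integral_nonneg (hpos x)
  have hJK : ∀ x, J x ≤ K := fun x => by
    refine (ENNReal.ofReal_le_ofReal_iff hK0).1 ?_
    rw [hJ, ofReal_integral_eq_lintegral_ofReal (hint x) (Eventually.of_forall (hpos x))]
    exact hlin x
  have hJm : StronglyMeasurable J :=
    StronglyMeasurable.integral_prod_right (f := fun x y : Plane => ‖u y‖ ^ 2 / ‖x - y‖)
      hmeas.stronglyMeasurable
  have hinner : ∀ x : Plane, ∫ y : Plane, ‖u x‖ ^ 2 * ‖u y‖ ^ 2 / ‖x - y‖ = ‖u x‖ ^ 2 * J x :=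
    fun x => by simp only [mul_div_assoc, integral_const_mul, hJ]
  have hle : ∀ x, ‖u x‖ ^ 2 * J x ≤ ‖u x‖ ^ 2 * K := fun x =>
    mul_le_mul_of_nonneg_left (hJK x) (by positivity)
  have hnn : ∀ x, 0 ≤ ‖u x‖ ^ 2 * J x := fun x => mul_nonneg (by positivity) (hJ0 x)
  have hKi : Integrable fun x => ‖u x‖ ^ 2 * K := hu.2.1.mul_const K
  have houter : Integrable fun x => ‖u x‖ ^ 2 * J x := by
    refine hKi.mono' ((hcu.norm.pow 2).aestronglyMeasurable.mul hJm.aestronglyMeasurable) ?_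
    exact Eventually.of_forall fun x => by rw [Real.norm_of_nonneg (hnn x)]; exact hle x
  simp only [hinner]
  have hlog0 : ∀ x y : Plane, 0 ≤ Real.log (1 + 1 / ‖x - y‖) * ‖u x‖ ^ 2 * ‖u y‖ ^ 2 :=
    fun x y => by
      have : 0 ≤ Real.log (1 + 1 / ‖x - y‖) := Real.log_nonneg (by simp)
      positivity
  constructor
  · refine integral_mono_of_nonneg (Eventually.of_forall fun x => integral_nonneg (hlog0 x))
      houter (Eventually.of_forall fun x => ?_)
    simp only [hJ, ← integral_const_mul]
    refine integral_mono_of_nonneg (Eventually.of_forall (hlog0 x))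
      ((hint x).const_mul _) (Eventually.of_forall fun y => ?_)
    have hlog : Real.log (1 + 1 / ‖x - y‖) ≤ 1 / ‖x - y‖ := by
      have := Real.log_le_sub_one_of_pos (x := 1 + 1 / ‖x - y‖) (by positivity)
      linarith
    calc Real.log (1 + 1 / ‖x - y‖) * ‖u x‖ ^ 2 * ‖u y‖ ^ 2
        ≤ 1 / ‖x - y‖ * ‖u x‖ ^ 2 * ‖u y‖ ^ 2 := by gcongr
      _ = ‖u x‖ ^ 2 * (‖u y‖ ^ 2 / ‖x - y‖) := by ring
  · calc ∫ x, ‖u x‖ ^ 2 * J x ≤ ∫ x, ‖u x‖ ^ 2 * K := integral_mono houter hKi hle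
      _ = a * K := by rw [integral_mul_const, hua]
      _ = _ := by
        have : a ^ ((3 : ℝ) / 2) = a * Real.sqrt a := by
          rw [Real.sqrt_eq_rpow, ← Real.rpow_one_add' ha.le (by norm_num)]
          norm_num
        rw [this, hK]; ring

end
end
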